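/- Let n > 3k and δ > 0 be sufficiently small in terms of n and k. Suppose A, B ≥ 2 satisfy A^{k/(1−δ)} < B^{n−k}. With Λ_{b,c} = {x ∈ ℤ^n : x·T^i(rev(b)) = x·T^i(rev(c)) = 0, 0 ≤ i ≤ k−1} and ∧(b,c) the vector of 2k×2k minors of the matrix formed by T^0(rev(b)),...,T^{k−1}(rev(b)),T^0(rev(c)),...,T^{k−1}(rev(c)), the number of triples (a, b_1, b_2) ∈ (ℤ^n)^3 with ‖a‖ ∈ [A,2A], ‖b_1‖, ‖b_2‖ ∈ [B,2B], a ∈ Λ_{b_1,b_2}, and ∧(b_1,b_2) = 0 is ≪ A^{n−2k} B^{2n−2k−δ/3}. -/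

import Mathlib

/-- The shift-with-`θ` map on `ℝ^n`. -/
noncomputable def Tmap (n : ℕ) (θ : ℤ) (v : Fin n → ℝ) : Fin n → ℝ :=
  fun j => if h : (j : ℕ) + 1 < n then v ⟨(j : ℕ) + 1, h⟩ else (θ : ℝ) * v ⟨0, j.pos⟩

/-- The shift-with-`θ` map on `ℤ^n`. -/
def TmapZ (n : ℕ) (θ : ℤ) (v : Fin n → ℤ) : Fin n → ℤ :=
  fun j => if h : (j : ℕ) + 1 < n then v ⟨(j : ℕ) + 1, h⟩ else θ * v ⟨0, j.pos⟩

/-- Coordinate reversal. -/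
def revZ (n : ℕ) (v : Fin n → ℤ) : Fin n → ℤ := fun j => v j.rev

/-- Euclidean norm of an integer vector. -/
noncomputable def nrmZ {n : ℕ} (x : Fin n → ℤ) : ℝ := Real.sqrt (∑ i, ((x i : ℝ)) ^ 2)

/-- The function `e ↦ e + 1` is dominated by exponentials. -/
theorem natCast_add_one_le_mul_rpow {ε : ℝ} (hε : 0 < ε) (x : ℝ) (hx : 2 ≤ x) (e : ℕ) :
    (e : ℝ) + 1 ≤ max 1 (1 / (ε * Real.log 2)) * (x ^ ε) ^ e := by
  have hl : 0 < Real.log 2 := Real.log_pos (by norm_num)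
  have h1 : (x ^ ε) ^ e = Real.exp (ε * e * Real.log x) := by
    rw [← Real.rpow_mul_natCast (by linarith), Real.rpow_def_of_pos (by linarith)]
    ring_nf
  have h2 : ε * Real.log 2 * e + 1 ≤ (x ^ ε) ^ e := by
    rw [h1]
    refine le_trans ?_ (Real.add_one_le_exp _)
    have := Real.log_le_log (by norm_num) hx
    nlinarith [mul_nonneg hε.le (Nat.cast_nonneg (α := ℝ) e),
      mul_le_mul_of_nonneg_left this (mul_nonneg hε.le (Nat.cast_nonneg (α := ℝ) e))]
  set K := max 1 (1 / (ε * Real.log 2)) with hK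
  have hK1 : 1 ≤ K := le_max_left _ _
  have hK2 : 1 ≤ K * (ε * Real.log 2) := by
    have : 1 / (ε * Real.log 2) ≤ K := le_max_right _ _
    rwa [div_le_iff₀ (by positivity)] at this
  calc (e : ℝ) + 1 ≤ K * (ε * Real.log 2 * e + 1) := by
        nlinarith [mul_le_mul_of_nonneg_right hK2 (Nat.cast_nonneg (α := ℝ) e)]
    _ ≤ _ := by gcongr

theorem natCast_add_one_le_rpow_pow {ε : ℝ} (hε : 0 < ε) (x : ℝ) (hx : (2 : ℝ) ^ (1 / ε) ≤ x)
    (e : ℕ) : (e : ℝ) + 1 ≤ (x ^ ε) ^ e := by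
  have h2 : (2 : ℝ) ≤ x ^ ε := by
    have := Real.rpow_le_rpow (by positivity) hx hε.le
    rwa [← Real.rpow_mul (by norm_num), one_div_mul_cancel hε.ne', Real.rpow_one] at this
  have := one_add_mul_le_pow (a := x ^ ε - 1) (by linarith) e
  rw [add_sub_cancel] at this
  nlinarith [Nat.cast_nonneg (α := ℝ) e]

open UniqueFactorizationMonoid in
/-- The divisor bound for ideals in the ring of integers of a number field. -/
theorem exists_card_ideal_divisors_le (K : Type*) [Field K] [NumberField K] {ε : ℝ} (hε : 0 < ε) :
    ∃ C : ℝ, 1 ≤ C ∧ ∀ I : Ideal (NumberField.RingOfIntegers K), I ≠ 0 →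
      {J | J ∣ I}.Finite ∧ ({J | J ∣ I}.ncard : ℝ) ≤ C * (Ideal.absNorm I : ℝ) ^ ε := by
  classical
  set c := max 1 (1 / (ε * Real.log 2)) with hc
  have hc1 : 1 ≤ c := le_max_left _ _
  have hfin := Ideal.finite_setOfPred_absNorm_le (S := NumberField.RingOfIntegers K)
    ⌈(2 : ℝ) ^ (1 / ε)⌉₊
  set S := hfin.toFinset with hS
  refine ⟨c ^ S.card, one_le_pow₀ hc1, fun I hI => ?_⟩
  have hmaps : Set.MapsTo (fun J => normalizedFactors J) {J | J ∣ I}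
      (Finset.Iic (normalizedFactors I) : Set (Multiset (Ideal (NumberField.RingOfIntegers K)))) := by
    intro J hJ
    have hJ0 : J ≠ 0 := ne_zero_of_dvd_ne_zero hI hJ
    simpa using (dvd_iff_normalizedFactors_le_normalizedFactors hJ0 hI).1 hJ
  have hinj : Set.InjOn (fun J => normalizedFactors J) {J | J ∣ I} := by
    intro J hJ J' hJ' h
    have hJ0 : J ≠ 0 := ne_zero_of_dvd_ne_zero hI hJ
    have hJ0' : J' ≠ 0 := ne_zero_of_dvd_ne_zero hI hJ'
    rw [← Ideal.prod_normalizedFactors_eq_self hJ0, ← Ideal.prod_normalizedFactors_eq_self hJ0']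
    exact congrArg _ h
  refine ⟨Set.Finite.of_injOn hmaps hinj (Finset.finite_toSet _), ?_⟩
  have hcard := Set.ncard_le_ncard_of_injOn _ hmaps hinj (Finset.finite_toSet _)
  rw [Set.ncard_coe_finset, Multiset.card_Iic] at hcard
  set s := normalizedFactors I with hs
  have hprod : (Ideal.absNorm I : ℝ) ^ ε
      = ∏ p ∈ s.toFinset, ((Ideal.absNorm p : ℝ) ^ ε) ^ s.count p := by
    conv_lhs => rw [← Ideal.prod_normalizedFactors_eq_self hI, ← hs,
      Finset.prod_multiset_count, map_prod]
    push_cast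
    rw [← Real.finsetProd_rpow _ _ (fun _ _ => by positivity)]
    refine Finset.prod_congr rfl fun p _ => ?_
    rw [map_pow]
    push_cast
    rw [← Real.rpow_natCast, ← Real.rpow_natCast, ← Real.rpow_mul (by positivity),
      ← Real.rpow_mul (by positivity), mul_comm]
  have htwo : ∀ p ∈ s.toFinset, (2 : ℝ) ≤ Ideal.absNorm p := by
    intro p hp
    have hpp : Prime p := prime_of_normalized_factor p (Multiset.mem_toFinset.1 hp)
    have h0 : Ideal.absNorm p ≠ 0 := by
      rw [Ne, Ideal.absNorm_eq_zero_iff]; exact hpp.ne_zero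
    have h1 : Ideal.absNorm p ≠ 1 := by
      rw [Ne, Ideal.absNorm_eq_one_iff]
      intro h; exact hpp.not_isUnit (Ideal.isUnit_iff.2 h)
    exact_mod_cast (by omega : 2 ≤ Ideal.absNorm p)
  calc ({J | J ∣ I}.ncard : ℝ) ≤ ∏ p ∈ s.toFinset, ((s.count p : ℝ) + 1) := by exact_mod_cast hcard
    _ ≤ ∏ p ∈ s.toFinset, ((if p ∈ S then c else 1) *
          ((Ideal.absNorm p : ℝ) ^ ε) ^ s.count p) := by
        refine Finset.prod_le_prod (fun _ _ => by positivity) fun p hp => ?_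
        split_ifs with hpS
        · exact natCast_add_one_le_mul_rpow hε _ (htwo p hp) _
        · rw [one_mul]
          refine natCast_add_one_le_rpow_pow hε _ ?_ _
          rw [hS, Set.Finite.mem_toFinset, Set.mem_ofPred_eq, not_le] at hpS
          exact (Nat.le_ceil _).trans (by exact_mod_cast hpS.le)
    _ = (∏ p ∈ s.toFinset, (if p ∈ S then c else 1)) * (Ideal.absNorm I : ℝ) ^ ε := by
        rw [Finset.prod_mul_distrib, hprod]
    _ ≤ _ := by
        gcongr
        rw [Finset.prod_ite, Finset.prod_const_one, mul_one, Finset.prod_const]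
        refine pow_le_pow_right₀ hc1 (Finset.card_le_card ?_)
        intro p hp
        exact (Finset.mem_filter.1 hp).2

open NumberField in
theorem norm_norm_le_pow {K : Type*} [Field K] [NumberField K] {Y : ℝ} (x : K)
    (hx : ∀ σ : K →+* ℂ, ‖σ x‖ ≤ Y) (σ : K →+* ℂ) :
    ‖Algebra.norm ℚ x‖ ≤ ‖σ x‖ * Y ^ (Module.finrank ℚ K - 1) := by
  have hY : 0 ≤ Y := (norm_nonneg _).trans (hx σ)
  have hh : house x ≤ Y := (pi_norm_le_iff_of_nonneg hY).2 hx
  have h0 : 0 ≤ house x := norm_nonneg _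
  exact (norm_norm_le_norm_mul_house_pow x σ).trans (by gcongr)

open NumberField in
theorem one_le_norm_norm {K : Type*} [Field K] [NumberField K] {x : 𝓞 K} (hx : x ≠ 0) :
    1 ≤ ‖Algebra.norm ℚ (x : K)‖ := by
  rw [← Algebra.coe_norm_int, Int.norm_cast_rat, Int.norm_eq_abs, ← Int.cast_abs]
  exact_mod_cast Int.one_le_abs (Algebra.norm_ne_zero_iff.2 hx)

open NumberField in
/-- The divisor bound for algebraic integers: the number of divisors of `c` whose conjugates are
bounded by `Y`, where `Y` also bounds the conjugates of `c`, is `O(Y ^ ε)`. -/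
theorem exists_card_bounded_divisors_le (K : Type*) [Field K] [NumberField K] {ε : ℝ}
    (hε : 0 < ε) :
    ∃ C : ℝ, 0 < C ∧ ∀ Y : ℝ, 1 ≤ Y → ∀ c : 𝓞 K, c ≠ 0 → (∀ σ : K →+* ℂ, ‖σ c‖ ≤ Y) →
      {x : 𝓞 K | x ∣ c ∧ ∀ σ : K →+* ℂ, ‖σ x‖ ≤ Y}.Finite ∧
      ({x : 𝓞 K | x ∣ c ∧ ∀ σ : K →+* ℂ, ‖σ x‖ ≤ Y}.ncard : ℝ) ≤ C * Y ^ ε := by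
  classical
  set n := Module.finrank ℚ K with hn
  have hn0 : 0 < n := Module.finrank_pos
  have hnR : (1 : ℝ) ≤ n := by exact_mod_cast hn0
  have hcardσ : Fintype.card (K →+* ℂ) = n := Embeddings.card K ℂ
  set η := ε / (2 * n) with hη
  have hη0 : 0 < η := by positivity
  obtain ⟨C₁, hC₁, hdiv⟩ := exists_card_ideal_divisors_le K hη0
  have hE := Embeddings.finite_of_norm_le K ℂ (Real.exp 1)
  set E := {x : K | IsIntegral ℤ x ∧ ∀ φ : K →+* ℂ, ‖φ x‖ ≤ Real.exp 1} with hEdef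
  set C₂ : ℝ := 2 * n / η + 3 with hC₂
  have hC₂0 : 0 < C₂ := by positivity
  refine ⟨(E.ncard + 1) * (C₁ * C₂ ^ n), by positivity, fun Y hY c hc hcY => ?_⟩
  have hY0 : 0 < Y := by linarith
  set D := {x : 𝓞 K | x ∣ c ∧ ∀ σ : K →+* ℂ, ‖σ x‖ ≤ Y} with hD
  have hDfin : D.Finite := by
    refine Set.Finite.of_injOn (f := fun x : 𝓞 K => (x : K)) (fun x hx => ?_)
      (RingOfIntegers.coe_injective.injOn) (Embeddings.finite_of_norm_le K ℂ Y)
    exact ⟨x.isIntegral_coe, hx.2⟩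
  refine ⟨hDfin, ?_⟩
  have hne : ∀ x ∈ D, x ≠ 0 := fun x hx => ne_zero_of_dvd_ne_zero hc hx.1
  obtain ⟨hIfin, hIcard⟩ := hdiv (Ideal.span {c}) (by simpa using hc)
  set M := ⌈n * Real.log Y⌉₊ with hM
  have hlogY : 0 ≤ Real.log Y := Real.log_nonneg hY
  have hMl : n * Real.log Y ≤ M := Nat.le_ceil _
  have hMu : (M : ℝ) ≤ n * Real.log Y + 1 := (Nat.ceil_lt_add_one (by positivity)).le
  have hbox : ∀ x ∈ D, ∀ σ : K →+* ℂ, ⌊Real.log ‖σ x‖⌋ ∈ Finset.Icc (-M : ℤ) M := by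
    intro x hx σ
    have hσ0 : 0 < ‖σ x‖ := by
      rw [norm_pos_iff, map_ne_zero]
      exact RingOfIntegers.coe_ne_zero_iff.2 (hne x hx)
    rw [Finset.mem_Icc, Int.le_floor]
    have h1 : 1 ≤ ‖σ x‖ * Y ^ (n - 1) :=
      (one_le_norm_norm (hne x hx)).trans (norm_norm_le_pow (x : K) hx.2 σ)
    have h2 : 0 ≤ Real.log ‖σ x‖ + (n - 1 : ℕ) * Real.log Y := by
      rw [← Real.log_pow, ← Real.log_mul hσ0.ne' (by positivity)]
      exact Real.log_nonneg h1
    have h3 : ((n - 1 : ℕ) : ℝ) ≤ n := by exact_mod_cast Nat.sub_le _ _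
    have h4 := mul_le_mul_of_nonneg_right h3 hlogY
    have h5 := Real.log_le_log hσ0 (hx.2 σ)
    constructor
    · push_cast
      linarith
    · rw [← Int.cast_le (R := ℝ)]
      refine (Int.floor_le _).trans ?_
      push_cast
      nlinarith
  set Ψ : 𝓞 K → Ideal (𝓞 K) × ((K →+* ℂ) → ℤ) :=
    fun x => (Ideal.span {x}, fun σ => ⌊Real.log ‖σ x‖⌋) with hΨ
  have hfib : ∀ b ∈ hDfin.toFinset.image Ψ, (hDfin.toFinset.filter (Ψ · = b)).card ≤ E.ncard := by
    intro b hb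
    obtain ⟨y, hy, rfl⟩ := Finset.mem_image.1 hb
    rw [Set.Finite.mem_toFinset] at hy
    have hyK : (y : K) ≠ 0 := RingOfIntegers.coe_ne_zero_iff.2 (hne y hy)
    rw [Set.ncard_eq_toFinset_card _ hE]
    refine Finset.card_le_card_of_injOn (fun x => (x : K) / y) (fun x hx => ?_) ?_
    · simp only [Finset.coe_filter, Set.Finite.mem_toFinset, Set.mem_ofPred_eq] at hx
      obtain ⟨hxD, hxy⟩ := hx
      have hxK : (x : K) ≠ 0 := RingOfIntegers.coe_ne_zero_iff.2 (hne x hxD)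
      simp only [hΨ, Prod.mk.injEq] at hxy
      obtain ⟨u, hu⟩ := (Ideal.span_singleton_le_span_singleton.1 hxy.1.le)
      simp only [Set.Finite.coe_toFinset]
      refine ⟨?_, fun σ => ?_⟩
      · rw [hu]
        rw [show ((y * u : 𝓞 K) : K) = y * u from map_mul _ _ _, mul_div_cancel_left₀ _ hyK]
        exact u.isIntegral_coe
      · have hx0 : 0 < ‖σ x‖ := by rwa [norm_pos_iff, map_ne_zero]
        have hy0 : 0 < ‖σ y‖ := by rwa [norm_pos_iff, map_ne_zero]
        rw [map_div₀, norm_div, ← Real.log_le_iff_le_exp (by positivity),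
          Real.log_div hx0.ne' hy0.ne']
        have h := congrFun hxy.2 σ
        have h1 := Int.lt_floor_add_one (Real.log ‖σ x‖)
        have h2 := Int.floor_le (Real.log ‖σ y‖)
        have h3 : (⌊Real.log ‖σ x‖⌋ : ℝ) = ⌊Real.log ‖σ y‖⌋ := by exact_mod_cast h
        linarith
    · intro x _ x' _ h
      exact RingOfIntegers.coe_injective ((div_left_inj' hyK).1 h)
  have himg : hDfin.toFinset.image Ψ ⊆
      hIfin.toFinset ×ˢ Fintype.piFinset (fun _ => Finset.Icc (-M : ℤ) M) := by
    intro b hb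
    obtain ⟨x, hx, rfl⟩ := Finset.mem_image.1 hb
    rw [Set.Finite.mem_toFinset] at hx
    rw [Finset.mem_product, Set.Finite.mem_toFinset, Fintype.mem_piFinset]
    refine ⟨?_, hbox x hx⟩
    obtain ⟨z, hz⟩ := hx.1
    exact ⟨Ideal.span {z}, by rw [Ideal.span_singleton_mul_span_singleton, hz]⟩
  have hcard : D.ncard ≤ E.ncard * ({J | J ∣ Ideal.span {c}}.ncard * (2 * M + 1) ^ n) := by
    rw [Set.ncard_eq_toFinset_card _ hDfin]
    refine (Finset.card_le_mul_card_image _ _ hfib).trans (Nat.mul_le_mul_left _ ?_)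
    refine (Finset.card_le_card himg).trans (le_of_eq ?_)
    rw [Finset.card_product, Set.ncard_eq_toFinset_card _ hIfin, Fintype.card_piFinset,
      Finset.prod_const, Int.card_Icc, Finset.card_univ, hcardσ]
    congr 2
    omega
  have hnorm : (Ideal.absNorm (Ideal.span {c}) : ℝ) ≤ Y ^ n := by
    obtain ⟨σ⟩ : Nonempty (K →+* ℂ) := inferInstance
    have h1 := norm_norm_le_pow (c : K) hcY σ
    rw [Ideal.absNorm_span_singleton, Nat.cast_natAbs, Int.cast_abs]
    rw [← Algebra.coe_norm_int, Int.norm_cast_rat, Int.norm_eq_abs] at h1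
    refine h1.trans ?_
    calc ‖σ c‖ * Y ^ (n - 1) ≤ Y * Y ^ (n - 1) := by gcongr; exact hcY σ
      _ = Y ^ n := mul_pow_sub_one hn0.ne' Y
  have hideal : ({J | J ∣ Ideal.span {c}}.ncard : ℝ) ≤ C₁ * Y ^ (ε / 2) := by
    refine hIcard.trans ?_
    gcongr
    refine (Real.rpow_le_rpow (by positivity) hnorm hη0.le).trans (le_of_eq ?_)
    rw [← Real.rpow_natCast_mul hY0.le, hη]
    congr 1
    field_simp
  have hM2 : (2 * M + 1 : ℝ) ≤ C₂ * Y ^ η := by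
    have h1 := Real.log_le_rpow_div hY0.le hη0
    have h2 : 1 ≤ Y ^ η := Real.one_le_rpow hY hη0.le
    calc (2 * M + 1 : ℝ) ≤ 2 * n * Real.log Y + 3 := by linarith
      _ ≤ 2 * n * (Y ^ η / η) + 3 * Y ^ η := by gcongr; linarith
      _ = C₂ * Y ^ η := by rw [hC₂]; ring
  calc (D.ncard : ℝ) ≤ E.ncard * ({J | J ∣ Ideal.span {c}}.ncard * (2 * M + 1) ^ n) := by
        exact_mod_cast hcard
    _ ≤ (E.ncard + 1) * ((C₁ * Y ^ (ε / 2)) * (C₂ * Y ^ η) ^ n) := by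
        gcongr
        linarith
    _ = (E.ncard + 1) * (C₁ * C₂ ^ n) * Y ^ ε := by
        have : (Y ^ η) ^ n = Y ^ (ε / 2) := by
          rw [← Real.rpow_mul_natCast hY0.le, hη]
          congr 1
          field_simp
        rw [mul_pow, this, show ε = ε / 2 + ε / 2 by ring, Real.rpow_add hY0]
        ring_nf

open Finset in
/-- The number of integer vectors with `∏ i, max 1 |z i| ≤ W` is `O(W ^ (1 + η))`. -/
theorem exists_ncard_prod_max_one_abs_le (ι : Type*) [Fintype ι] {η : ℝ} (hη : 0 < η) :
    ∃ S : ℝ, 0 < S ∧ ∀ W : ℝ, 0 ≤ W →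
      {z : ι → ℤ | ∏ i, max 1 |(z i : ℝ)| ≤ W}.Finite ∧
      ({z : ι → ℤ | ∏ i, max 1 |(z i : ℝ)| ≤ W}.ncard : ℝ) ≤ S * W ^ (1 + η) := by
  classical
  set w : ℤ → ℝ := fun c => (max 1 |(c : ℝ)|) ^ (-(1 + η)) with hw
  have hw0 : ∀ c, 0 < w c := fun c => by positivity
  have hsum : Summable w := by
    have h := (Real.summable_abs_int_rpow (b := 1 + η) (by linarith)).add
      (summable_of_hasFiniteSupport (f := fun c : ℤ => if c = 0 then (1 : ℝ) else 0)
        ((Set.finite_singleton 0).subset fun c hc => by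
          by_contra h0
          exact hc (if_neg h0)))
    refine Summable.of_nonneg_of_le (fun c => (hw0 c).le) (fun c => ?_) h
    by_cases hc : c = 0
    · subst hc
      simp only [hw, Int.cast_zero, abs_zero, if_true]
      rw [max_eq_left zero_le_one, Real.one_rpow]
      have := Real.rpow_nonneg (le_refl (0 : ℝ)) (-(1 + η))
      linarith
    · have h1 : (1 : ℝ) ≤ |(c : ℝ)| := by exact_mod_cast Int.one_le_abs hc
      simp [hw, hc, max_eq_right h1]
  set s := ∑' c, w c with hs
  have hs0 : 0 < s := hsum.tsum_pos (fun c => (hw0 c).le) 0 (hw0 0)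
  refine ⟨s ^ Fintype.card ι, by positivity, fun W hW => ?_⟩
  have hle : ∀ z : ι → ℤ, ∏ i, max 1 |(z i : ℝ)| ≤ W → ∀ i, |z i| ≤ ⌊W⌋ := by
    intro z hz i
    rw [Int.le_floor, Int.cast_abs]
    refine (le_max_right 1 _).trans (le_trans ?_ hz)
    rw [← mul_prod_erase univ _ (mem_univ i)]
    refine le_mul_of_one_le_right (by positivity) ?_
    exact prod_induction _ (1 ≤ ·) (fun _ _ => one_le_mul_of_one_le_of_one_le) le_rfl
      fun _ _ => le_max_left _ _
  set box := Fintype.piFinset fun _ : ι => Icc (-⌊W⌋) ⌊W⌋ with hbox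
  have hsub : {z : ι → ℤ | ∏ i, max 1 |(z i : ℝ)| ≤ W} ⊆ box := by
    intro z hz
    rw [mem_coe, Fintype.mem_piFinset]
    intro i
    rw [mem_Icc, ← abs_le]
    exact hle z hz i
  have hfin := box.finite_toSet.subset hsub
  refine ⟨hfin, ?_⟩
  rw [Set.ncard_eq_toFinset_card _ hfin]
  calc (hfin.toFinset.card : ℝ) = ∑ z ∈ hfin.toFinset, (1 : ℝ) := by simp
    _ ≤ ∑ z ∈ hfin.toFinset, W ^ (1 + η) * ∏ i, w (z i) := by
        refine sum_le_sum fun z hz => ?_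
        have hz' : ∏ i, max 1 |(z i : ℝ)| ≤ W := by simpa using hz
        have hp : 0 < ∏ i, max 1 |(z i : ℝ)| := prod_pos fun _ _ => by positivity
        rw [Real.finsetProd_rpow _ _ (fun _ _ => by positivity), Real.rpow_neg hp.le,
          ← div_eq_mul_inv, one_le_div (by positivity)]
        exact Real.rpow_le_rpow hp.le hz' (by linarith)
    _ ≤ ∑ z ∈ box, W ^ (1 + η) * ∏ i, w (z i) := by
        refine sum_le_sum_of_subset_of_nonneg (fun z hz => hsub (by simpa using hz)) ?_
        exact fun z _ _ => mul_nonneg (by positivity) (prod_nonneg fun i _ => (hw0 _).le)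
    _ = W ^ (1 + η) * ∏ _i : ι, ∑ c ∈ Icc (-⌊W⌋) ⌊W⌋, w c := by
        rw [← mul_sum, prod_univ_sum]
    _ ≤ W ^ (1 + η) * s ^ Fintype.card ι := by
        rw [prod_const, card_univ]
        gcongr
        exact hsum.sum_le_tsum _ (fun c _ => (hw0 c).le)
    _ = _ := mul_comm _ _

open Polynomial in
theorem prod_max_one_coeff_le {p : ℤ[X]} {d m : ℕ} {B : ℝ} (hB : 1 ≤ B)
    (hd : p.natDegree ≤ d) (hp : ∀ i, |(p.coeff i : ℝ)| ≤ B) :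
    ∏ i : Fin m, max 1 |(p.coeff i : ℝ)| ≤ B ^ (d + 1) := by
  rw [Fin.prod_univ_eq_prod_range (fun i => max 1 |(p.coeff i : ℝ)|)]
  calc ∏ i ∈ Finset.range m, max 1 |(p.coeff i : ℝ)|
      ≤ ∏ i ∈ Finset.range m, if i ∈ Finset.range (d + 1) then B else 1 := by
        refine Finset.prod_le_prod (fun _ _ => by positivity) fun i _ => ?_
        split_ifs with hi
        · exact max_le hB (hp i)
        · rw [coeff_eq_zero_of_natDegree_lt (by simp at hi; omega)]
          simp
    _ = B ^ (Finset.filter (· ∈ Finset.range (d + 1)) (Finset.range m)).card := by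
        rw [Finset.prod_ite, Finset.prod_const_one, mul_one, Finset.prod_const]
    _ ≤ B ^ (d + 1) := by
        refine pow_le_pow_right₀ hB ?_
        calc _ ≤ (Finset.range (d + 1)).card :=
              Finset.card_le_card fun i hi => (Finset.mem_filter.1 hi).2
          _ = d + 1 := Finset.card_range _

open Polynomial in
theorem abs_coeff_le_two_pow_mul_mahlerMeasure {p : ℤ[X]} {N : ℕ} (hN : p.natDegree ≤ N) (i : ℕ) :
    |(p.coeff i : ℝ)| ≤ 2 ^ N * (p.map (Int.castRingHom ℂ)).mahlerMeasure := by
  have h := (p.map (Int.castRingHom ℂ)).norm_coeff_le_choose_mul_mahlerMeasure i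
  rw [coeff_map, eq_intCast, Complex.norm_intCast] at h
  refine h.trans ?_
  gcongr
  · exact mahlerMeasure_nonneg _
  · have h1 : (p.map (Int.castRingHom ℂ)).natDegree ≤ N := natDegree_map_le.trans hN
    calc (((p.map (Int.castRingHom ℂ)).natDegree.choose i : ℕ) : ℝ)
        ≤ ((2 ^ (p.map (Int.castRingHom ℂ)).natDegree : ℕ) : ℝ) := by
          exact_mod_cast Nat.choose_le_two_pow _ _
      _ ≤ 2 ^ N := by
          push_cast
          exact pow_le_pow_right₀ (by norm_num) h1

open Polynomial in
theorem mahlerMeasure_le_mul_of_abs_coeff_le {p : ℤ[X]} {N : ℕ} {H : ℝ} (hN : p.natDegree < N)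
    (hH : ∀ i, |(p.coeff i : ℝ)| ≤ H) :
    (p.map (Int.castRingHom ℂ)).mahlerMeasure ≤ N * H := by
  refine (mahlerMeasure_le_sum_norm_coeff _).trans ?_
  rw [sum_over_range' _ (fun _ => norm_zero) N (natDegree_map_le.trans_lt hN)]
  refine (Finset.sum_le_card_nsmul _ _ H fun i _ => ?_).trans (by simp)
  rw [coeff_map, eq_intCast, Complex.norm_intCast]
  exact hH i

open Polynomial in
/-- Two integer polynomials of degree less than `N` that satisfy a nontrivial relation with
coefficients of degree less than `k` have a large common factor. -/
theorem exists_common_factor_of_relation {k N : ℕ} (hkN : 2 * k ≤ N) {p q F G : ℤ[X]} {H : ℝ}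
    (hp : p ≠ 0) (hq : q ≠ 0) (hpN : p.natDegree < N) (hqN : q.natDegree < N)
    (hpH : ∀ i, |(p.coeff i : ℝ)| ≤ H) (hqH : ∀ i, |(q.coeff i : ℝ)| ≤ H)
    (hF : F ≠ 0) (hG : G ≠ 0) (hFk : F.natDegree < k) (hGk : G.natDegree < k)
    (h : F * p = G * q) :
    ∃ g f c : ℤ[X], p = c * g ∧ q = c * f ∧ g.natDegree < k ∧ f.natDegree < k ∧
      c.natDegree < N ∧
      (∏ i : Fin k, max 1 |(g.coeff i : ℝ)|) * ((∏ i : Fin k, max 1 |(f.coeff i : ℝ)|) *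
        ∏ i : Fin N, max 1 |(c.coeff i : ℝ)|) ≤ (4 ^ N * N * H) ^ N := by
  obtain ⟨g, f, c, hrel, hcg, hcf⟩ := UniqueFactorizationMonoid.exists_reduced_factors p hp q
  have hc : c ≠ 0 := by rintro rfl; simp at hcg; exact hp hcg.symm
  have hg : g ≠ 0 := by rintro rfl; simp at hcg; exact hp hcg.symm
  have hf : f ≠ 0 := by rintro rfl; simp at hcf; exact hq hcf.symm
  have hgf : F * g = G * f := by
    rw [← hcg, ← hcf] at h
    refine mul_left_cancel₀ hc ?_
    linear_combination h
  have hgG : g ∣ G := hrel.dvd_of_dvd_mul_right ⟨F, by rw [← hgf, mul_comm]⟩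
  have hfF : f ∣ F := hrel.symm.dvd_of_dvd_mul_right ⟨G, by rw [hgf, mul_comm]⟩
  have hgk := (natDegree_le_of_dvd hgG hG).trans_lt hGk
  have hfk := (natDegree_le_of_dvd hfF hF).trans_lt hFk
  have hdg : c.natDegree + g.natDegree < N := by rwa [← natDegree_mul hc hg, hcg]
  have hdf : c.natDegree + f.natDegree < N := by rwa [← natDegree_mul hc hf, hcf]
  refine ⟨g, f, c, hcg.symm, hcf.symm, hgk, hfk, by omega, ?_⟩
  set μ : ℤ[X] → ℝ := fun r => (r.map (Int.castRingHom ℂ)).mahlerMeasure with hμ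
  have hμ1 : ∀ r : ℤ[X], r ≠ 0 → 1 ≤ μ r := fun r hr => one_le_mahlerMeasure_of_ne_zero hr
  have hμcg : μ c * μ g ≤ N * H := by
    simp only [hμ]
    rw [← mahlerMeasure_mul, ← Polynomial.map_mul, hcg]
    exact mahlerMeasure_le_mul_of_abs_coeff_le hpN hpH
  have hμcf : μ c * μ f ≤ N * H := by
    simp only [hμ]
    rw [← mahlerMeasure_mul, ← Polynomial.map_mul, hcf]
    exact mahlerMeasure_le_mul_of_abs_coeff_le hqN hqH
  set d := max g.natDegree f.natDegree with hd
  set A : ℝ := 2 ^ N * max (μ g) (μ f) with hA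
  set B : ℝ := 2 ^ N * μ c with hB
  have h2 : (1 : ℝ) ≤ 2 ^ N := one_le_pow₀ (by norm_num)
  have hA1 : 1 ≤ A := one_le_mul_of_one_le_of_one_le h2 ((hμ1 g hg).trans (le_max_left _ _))
  have hB1 : 1 ≤ B := one_le_mul_of_one_le_of_one_le h2 (hμ1 c hc)
  have hAB : A * B ≤ 4 ^ N * N * H := by
    have h4 : (4 : ℝ) ^ N = 2 ^ N * 2 ^ N := by rw [← mul_pow]; norm_num
    have : max (μ g) (μ f) * μ c ≤ N * H := by
      rcases max_choice (μ g) (μ f) with h | h <;> rw [h] <;> linarith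
    calc A * B = 4 ^ N * (max (μ g) (μ f) * μ c) := by rw [hA, hB, h4]; ring
      _ ≤ 4 ^ N * (N * H) := by gcongr
      _ = _ := by ring
  have hgA := prod_max_one_coeff_le (m := k) hA1 (le_max_left g.natDegree f.natDegree)
    fun i => (abs_coeff_le_two_pow_mul_mahlerMeasure (N := N) (by omega) i).trans
      (mul_le_mul_of_nonneg_left (le_max_left (μ g) (μ f)) (by positivity))
  have hfA := prod_max_one_coeff_le (m := k) hA1 (le_max_right g.natDegree f.natDegree)
    fun i => (abs_coeff_le_two_pow_mul_mahlerMeasure (N := N) (by omega) i).trans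
      (mul_le_mul_of_nonneg_left (le_max_right (μ g) (μ f)) (by positivity))
  have hcB := prod_max_one_coeff_le (m := N) hB1 le_rfl
    fun i => abs_coeff_le_two_pow_mul_mahlerMeasure (p := c) (N := N) (by omega) i
  calc _ ≤ A ^ (d + 1) * (A ^ (d + 1) * B ^ (c.natDegree + 1)) := by
        gcongr
    _ = A ^ (2 * (d + 1)) * B ^ (c.natDegree + 1) := by ring
    _ ≤ A ^ N * B ^ N := by
        have hdk : d < k := max_lt hgk hfk
        gcongr <;> first | assumption | omega
    _ = (A * B) ^ N := (mul_pow _ _ _).symm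
    _ ≤ _ := by gcongr

theorem ncard_le_mul_of_fiber {α β γ : Type*} {T : Set γ} {q : γ → β} {x : γ → α} {Q : Set β}
    {D : β → Set α} {M : ℝ} (hM : 0 ≤ M) (hinj : Set.InjOn (fun t => (q t, x t)) T)
    (hQ : Q.Finite) (hq : ∀ t ∈ T, q t ∈ Q) (hx : ∀ t ∈ T, x t ∈ D (q t))
    (hD : ∀ t ∈ T, (D (q t)).Finite ∧ ((D (q t)).ncard : ℝ) ≤ M) :
    (T.ncard : ℝ) ≤ Q.ncard * M := by
  classical
  have hmaps : ∀ t₀ ∈ T, Set.MapsTo x (T ∩ q ⁻¹' {q t₀}) (D (q t₀)) := by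
    rintro t₀ _ t ⟨ht, htq⟩
    rw [← show q t = q t₀ from htq]
    exact hx t ht
  have hinj' : ∀ t₀ ∈ T, Set.InjOn x (T ∩ q ⁻¹' {q t₀}) := by
    rintro t₀ _ t ⟨ht, htq⟩ t' ⟨ht', htq'⟩ h
    exact hinj ht ht' (Prod.ext (Eq.trans htq (Eq.symm htq')) h)
  have himg : q '' T ⊆ Q := Set.image_subset_iff.2 hq
  have hT : T.Finite := by
    refine Set.Finite.of_finite_fibers q (hQ.subset himg) ?_
    rintro _ ⟨t₀, ht₀, rfl⟩
    exact Set.Finite.of_injOn (hmaps t₀ ht₀) (hinj' t₀ ht₀) (hD t₀ ht₀).1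
  have hfib : ∀ b ∈ hT.toFinset.image q, (hT.toFinset.filter (q · = b)).card ≤ ⌊M⌋₊ := by
    intro b hb
    obtain ⟨t₀, ht₀, rfl⟩ := Finset.mem_image.1 hb
    rw [Set.Finite.mem_toFinset] at ht₀
    refine Nat.le_floor (le_trans ?_ (hD t₀ ht₀).2)
    rw [← Set.ncard_coe_finset]
    have hset : (hT.toFinset.filter (q · = q t₀) : Set γ) = T ∩ q ⁻¹' {q t₀} := by
      ext t
      simp
    rw [hset]
    exact_mod_cast Set.ncard_le_ncard_of_injOn x (hmaps t₀ ht₀) (hinj' t₀ ht₀) (hD t₀ ht₀).1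
  have hcard := Finset.card_le_mul_card_image _ _ hfib
  have himg' : (hT.toFinset.image q).card ≤ Q.ncard := by
    rw [Set.ncard_eq_toFinset_card _ hQ]
    refine Finset.card_le_card fun b hb => ?_
    obtain ⟨t, ht, rfl⟩ := Finset.mem_image.1 hb
    exact hQ.mem_toFinset.2 (hq t (hT.mem_toFinset.1 ht))
  rw [Set.ncard_eq_toFinset_card _ hT]
  calc (hT.toFinset.card : ℝ) ≤ ⌊M⌋₊ * (hT.toFinset.image q).card := by exact_mod_cast hcard
    _ ≤ M * Q.ncard := by
        gcongr
        exact Nat.floor_le hM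
    _ = _ := mul_comm _ _

theorem abs_le_nrmZ {n : ℕ} (x : Fin n → ℤ) (i : Fin n) : |(x i : ℝ)| ≤ nrmZ x :=
  Real.abs_le_sqrt (Finset.single_le_sum (f := fun i => (x i : ℝ) ^ 2)
    (fun _ _ => sq_nonneg _) (Finset.mem_univ i))

theorem ne_zero_of_nrmZ_pos {n : ℕ} {x : Fin n → ℤ} (h : 0 < nrmZ x) : x ≠ 0 := by
  rintro rfl
  simp [nrmZ] at h

theorem TmapZ_iterate_apply {n : ℕ} (θ : ℤ) (i j : ℕ) (h : j + i < n) (v : Fin n → ℤ) :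
    (TmapZ n θ)^[i] v ⟨j, by omega⟩ = v ⟨j + i, h⟩ := by
  induction i generalizing v with
  | zero => rfl
  | succ i ih =>
    rw [Function.iterate_succ_apply, ih (by omega), TmapZ, dif_pos (show j + i + 1 < n by omega)]
    rfl

theorem abs_TmapZ_iterate_le {n : ℕ} {θ : ℤ} (hθ : θ ≠ 0) {M : ℝ} {v : Fin n → ℤ}
    (hv : ∀ j, |(v j : ℝ)| ≤ M) (i : ℕ) (j : Fin n) :
    |((TmapZ n θ)^[i] v j : ℝ)| ≤ |(θ : ℝ)| ^ i * M := by
  have h1 : 1 ≤ |(θ : ℝ)| := by exact_mod_cast Int.one_le_abs hθ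
  induction i generalizing j with
  | zero => simpa using hv j
  | succ i ih =>
    rw [Function.iterate_succ_apply', TmapZ]
    split_ifs with h
    · refine (ih _).trans ?_
      have h0 : 0 ≤ |(θ : ℝ)| ^ i * M := (abs_nonneg _).trans (ih j)
      calc |(θ : ℝ)| ^ i * M ≤ |(θ : ℝ)| * (|(θ : ℝ)| ^ i * M) := le_mul_of_one_le_left h0 h1
        _ = _ := by ring
    · rw [Int.cast_mul, abs_mul, pow_succ', mul_assoc]
      gcongr
      exact ih _

theorem Tmap_iterate_intCast {n : ℕ} (θ : ℤ) (v : Fin n → ℤ) (i : ℕ) :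
    (Tmap n θ)^[i] (fun s => (v s : ℝ)) = fun s => ((TmapZ n θ)^[i] v s : ℝ) := by
  induction i generalizing v with
  | zero => rfl
  | succ i ih =>
    rw [Function.iterate_succ_apply, Function.iterate_succ_apply, ← ih]
    congr 1
    ext j
    simp only [Tmap, TmapZ]
    split_ifs <;> simp

open Polynomial in
/-- The polynomial of degree less than `n` whose coefficients are the entries of `v`, from the
highest to the lowest. -/
noncomputable def revPoly (n : ℕ) : (Fin n → ℤ) →ₗ[ℤ] ℤ[X] :=
  ofFn n ∘ₗ LinearMap.funLeft ℤ ℤ Fin.rev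

open Polynomial in
theorem revPoly_revZ {n : ℕ} (v : Fin n → ℤ) : revPoly n (revZ n v) = ofFn n v := by
  simp only [revPoly, LinearMap.comp_apply]
  congr 1
  ext i
  simp [LinearMap.funLeft_apply, revZ]

theorem coeff_revPoly_of_lt {n m : ℕ} (v : Fin n → ℤ) (h : m < n) :
    (revPoly n v).coeff m = v ⟨n - 1 - m, by omega⟩ := by
  rw [revPoly, LinearMap.comp_apply, Polynomial.ofFn_coeff_eq_val_of_lt _ h,
    LinearMap.funLeft_apply]
  congr 1
  ext
  simp only [Fin.val_rev]
  omega

theorem coeff_revPoly_of_ge {n m : ℕ} (v : Fin n → ℤ) (h : n ≤ m) :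
    (revPoly n v).coeff m = 0 := by
  rw [revPoly, LinearMap.comp_apply, Polynomial.ofFn_coeff_eq_zero_of_ge _ h]

open Polynomial in
theorem X_mul_revPoly {n : ℕ} (hn : 0 < n) (θ : ℤ) (v : Fin n → ℤ) :
    X * revPoly n v = revPoly n (TmapZ n θ v) + C (v ⟨0, hn⟩) * (X ^ n - C θ) := by
  ext m
  rw [coeff_add, coeff_C_mul, coeff_sub, coeff_X_pow, coeff_C]
  rcases m with _ | m
  · rw [coeff_X_mul_zero, coeff_revPoly_of_lt _ hn, TmapZ, dif_neg (by simp; omega),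
      if_neg hn.ne, if_pos rfl]
    ring
  · rw [coeff_X_mul, if_neg (Nat.succ_ne_zero m)]
    rcases lt_trichotomy (m + 1) n with h | h | h
    · rw [coeff_revPoly_of_lt _ (by omega), coeff_revPoly_of_lt _ h, TmapZ,
        dif_pos (by simp; omega), if_neg h.ne, sub_zero, mul_zero, add_zero]
      congr 1
      ext
      simp only
      omega
    · rw [coeff_revPoly_of_lt _ (by omega), coeff_revPoly_of_ge _ h.ge, if_pos h, sub_zero,
        mul_one, zero_add]
      congr 1
      ext
      simp only
      omega
    · rw [coeff_revPoly_of_ge _ (by omega), coeff_revPoly_of_ge _ h.le, if_neg h.ne']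
      ring

section Root

open Polynomial

variable {R : Type*} [CommRing R] {n : ℕ} {θ : ℤ} {ω : R}

theorem aeval_ofFn {m : ℕ} (v : Fin m → ℤ) (x : R) :
    aeval x (ofFn m v) = ∑ i, (v i : R) * x ^ (i : ℕ) := by
  rw [ofFn_eq_sum_monomial, map_sum]
  refine Finset.sum_congr rfl fun i _ => ?_
  rw [aeval_monomial]
  simp

theorem aeval_revPoly_TmapZ_iterate (hω : ω ^ n = θ) (hn : 0 < n) (v : Fin n → ℤ) (i : ℕ) :
    aeval ω (revPoly n ((TmapZ n θ)^[i] v)) = ω ^ i * aeval ω (revPoly n v) := by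
  induction i with
  | zero => simp
  | succ i ih =>
    rw [Function.iterate_succ_apply', pow_succ', mul_assoc, ← ih]
    have h := congrArg (aeval ω) (X_mul_revPoly hn θ ((TmapZ n θ)^[i] v))
    simp only [map_mul, map_add, map_sub, map_pow, aeval_X, map_intCast, hω, eq_intCast,
      sub_self, mul_zero, add_zero] at h
    exact h.symm

/-- The coordinates, in reversed order, of the product of the elements `∑ aⱼ ωʲ` and `∑ bⱼ ωʲ`,
where `v` is the reversal of `b`. -/
def shiftComb (n : ℕ) (θ : ℤ) (a v : Fin n → ℤ) : Fin n → ℤ :=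
  ∑ s : Fin n, a s • (TmapZ n θ)^[(s : ℕ)] v

theorem aeval_revPoly_shiftComb (hω : ω ^ n = θ) (hn : 0 < n) (a v : Fin n → ℤ) :
    aeval ω (revPoly n (shiftComb n θ a v)) =
      aeval ω (ofFn n a) * aeval ω (revPoly n v) := by
  rw [shiftComb, map_sum, map_sum, aeval_ofFn, Finset.sum_mul]
  refine Finset.sum_congr rfl fun s _ => ?_
  rw [map_smul, map_zsmul, aeval_revPoly_TmapZ_iterate hω hn, zsmul_eq_mul, mul_assoc]

theorem shiftComb_apply (a v : Fin n → ℤ) (i : ℕ) (hi : i < n) :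
    shiftComb n θ a v ⟨i, hi⟩ = ∑ s, a s * (TmapZ n θ)^[i] v s := by
  rw [shiftComb, Finset.sum_apply]
  refine Finset.sum_congr rfl fun s _ => ?_
  rw [Pi.smul_apply, smul_eq_mul]
  congr 1
  have hn : 0 + (s : ℕ) < n := by omega
  have h1 := TmapZ_iterate_apply θ i 0 (by omega) ((TmapZ n θ)^[(s : ℕ)] v)
  have h2 := TmapZ_iterate_apply θ (s : ℕ) 0 hn ((TmapZ n θ)^[i] v)
  simp only [zero_add] at h1 h2
  rw [← Function.iterate_add_apply] at h1 h2
  rw [← h1, ← h2, add_comm]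

theorem abs_shiftComb_le (hθ : θ ≠ 0) {A B : ℝ} {a v : Fin n → ℤ}
    (ha : ∀ j, |(a j : ℝ)| ≤ A) (hv : ∀ j, |(v j : ℝ)| ≤ B) (j : Fin n) :
    |(shiftComb n θ a v j : ℝ)| ≤ n * (A * (|(θ : ℝ)| ^ n * B)) := by
  have h1 : 1 ≤ |(θ : ℝ)| := by exact_mod_cast Int.one_le_abs hθ
  have hA : 0 ≤ A := (abs_nonneg _).trans (ha j)
  have hB : 0 ≤ B := (abs_nonneg _).trans (hv j)
  rw [shiftComb, Finset.sum_apply, Int.cast_sum]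
  refine (Finset.abs_sum_le_sum_abs _ _).trans ?_
  refine (Finset.sum_le_card_nsmul _ _ (A * (|(θ : ℝ)| ^ n * B)) fun s _ => ?_).trans (by simp)
  rw [Pi.smul_apply, smul_eq_mul, Int.cast_mul, abs_mul]
  refine mul_le_mul (ha s) ((abs_TmapZ_iterate_le hθ hv _ _).trans ?_) (abs_nonneg _) hA
  gcongr
  exact s.2.le

/-- If `a` is orthogonal to the first `k` shifts of the reversal of `b`, the product of the
elements `∑ aⱼ ωʲ` and `∑ bⱼ ωʲ` is the value at `ω` of a polynomial of degree less than
`n - k`. -/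
theorem exists_natDegree_lt_aeval_eq_mul (hω : ω ^ n = θ) (hθ : θ ≠ 0) {k : ℕ} (hkn : k < n)
    {A B : ℝ} {a b : Fin n → ℤ} (ha : ∀ j, |(a j : ℝ)| ≤ A) (hb : ∀ j, |(b j : ℝ)| ≤ B)
    (h : ∀ i < k, ∑ s, a s * (TmapZ n θ)^[i] (revZ n b) s = 0) :
    ∃ p : ℤ[X], p.natDegree < n - k ∧ aeval ω p = aeval ω (ofFn n a) * aeval ω (ofFn n b) ∧
      ∀ i, |(p.coeff i : ℝ)| ≤ n * (A * (|(θ : ℝ)| ^ n * B)) := by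
  have hn : 0 < n := by omega
  have hrb : ∀ j, |(revZ n b j : ℝ)| ≤ B := fun j => hb _
  refine ⟨revPoly n (shiftComb n θ a (revZ n b)), ?_, ?_, fun i => ?_⟩
  · refine Nat.lt_of_le_sub_one (by omega) (natDegree_le_iff_coeff_eq_zero.2 fun m hm => ?_)
    rcases lt_or_ge m n with hmn | hmn
    · rw [coeff_revPoly_of_lt _ hmn, shiftComb_apply]
      exact h _ (by omega)
    · exact coeff_revPoly_of_ge _ hmn
  · rw [aeval_revPoly_shiftComb hω hn, revPoly_revZ]
  · rcases lt_or_ge i n with hin | hin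
    · rw [coeff_revPoly_of_lt _ hin]
      exact abs_shiftComb_le hθ ha hrb _
    · rw [coeff_revPoly_of_ge _ hin, Int.cast_zero, abs_zero]
      have hA : 0 ≤ A := (abs_nonneg _).trans (ha ⟨0, hn⟩)
      have hB : 0 ≤ B := (abs_nonneg _).trans (hb ⟨0, hn⟩)
      positivity

theorem exists_relation_of_not_linearIndependent (hω : ω ^ n = θ) (hn : 0 < n) {k m : ℕ}
    (hk : 1 ≤ k) (hm : m = k + k) {v w : Fin n → ℤ}
    (h : ¬ LinearIndependent ℝ (fun i : Fin m =>
      if (i : ℕ) < k then (Tmap n θ)^[(i : ℕ)] (fun s => (v s : ℝ))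
      else (Tmap n θ)^[(i : ℕ) - k] (fun s => (w s : ℝ)))) :
    ∃ F G : ℤ[X], (F ≠ 0 ∨ G ≠ 0) ∧ F.natDegree < k ∧ G.natDegree < k ∧
      aeval ω F * aeval ω (revPoly n v) = aeval ω G * aeval ω (revPoly n w) := by
  subst hm
  set u : Fin (k + k) → Fin n → ℤ := fun i =>
    if (i : ℕ) < k then (TmapZ n θ)^[(i : ℕ)] v else (TmapZ n θ)^[(i : ℕ) - k] w with hu
  have hu' : (fun i : Fin (k + k) =>
      if (i : ℕ) < k then (Tmap n θ)^[(i : ℕ)] (fun s => (v s : ℝ))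
      else (Tmap n θ)^[(i : ℕ) - k] (fun s => (w s : ℝ))) =
      fun i => algebraMap ℤ ℝ ∘ u i := by
    ext i s
    simp only [Tmap_iterate_intCast, hu]
    split_ifs <;> simp
  rw [hu', linearIndependent_algebraMap_comp_iff, Fintype.not_linearIndependent_iff] at h
  obtain ⟨g, hg, i₀, hi₀⟩ := h
  refine ⟨ofFn k (fun i => g (Fin.castAdd k i)), - ofFn k (fun i => g (Fin.natAdd k i)), ?_,
    ofFn_natDegree_lt hk _, ?_, ?_⟩
  · by_contra! hFG
    obtain ⟨hF, hG⟩ := hFG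
    refine hi₀ ?_
    refine Fin.addCases (motive := fun i => g i = 0) (fun i => ?_) (fun i => ?_) i₀
    · have := congrArg (fun p => p.coeff (i : ℕ)) hF
      simpa [ofFn_coeff_eq_val_of_lt] using this
    · have := congrArg (fun p => p.coeff (i : ℕ)) (neg_eq_zero.1 hG)
      simpa [ofFn_coeff_eq_val_of_lt] using this
  · rw [natDegree_neg]
    exact ofFn_natDegree_lt hk _
  · have h := congrArg (fun x => aeval ω (revPoly n x)) hg
    simp only [map_sum, map_smul, map_zero] at h
    rw [Fin.sum_univ_add] at h
    simp only [hu, Fin.val_castAdd, Fin.is_lt, if_true, Fin.val_natAdd, add_lt_iff_neg_left,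
      not_lt_zero, if_false, Nat.add_sub_cancel_left, zsmul_eq_mul,
      aeval_revPoly_TmapZ_iterate hω hn, ← mul_assoc, ← Finset.sum_mul] at h
    rw [map_neg, aeval_ofFn, aeval_ofFn]
    linear_combination h

end Root

section Count

open Polynomial

theorem ofFn_coeff_of_natDegree_lt {m : ℕ} {p : ℤ[X]} (hp : p.natDegree < m) :
    ofFn m (fun i => p.coeff i) = p := by
  ext i
  rcases lt_or_ge i m with h | h
  · rw [ofFn_coeff_eq_val_of_lt _ h]
  · rw [ofFn_coeff_eq_zero_of_ge _ h, coeff_eq_zero_of_natDegree_lt (hp.trans_le h)]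

variable {n k : ℕ} {θ : ℤ}

theorem aeval_ofFn_injective {R : Type*} [CommRing R] {x : R} (hn : 0 < n)
    (hinj : ∀ p : ℤ[X], p.natDegree < n → aeval x p = 0 → p = 0) :
    Function.Injective fun v : Fin n → ℤ => aeval x (ofFn n v) := by
  intro v w h
  have hvw := hinj (ofFn n (v - w)) (ofFn_natDegree_lt hn _)
    (by rw [map_sub, map_sub, sub_eq_zero]; exact h)
  ext i
  refine sub_eq_zero.1 ?_
  simpa [-map_sub, ofFn_coeff_eq_val_of_lt] using congrArg (fun p => p.coeff (i : ℕ)) hvw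

/-- A triple `(a, b, b')` with vanishing exterior product: the products `α β` and `α β'` are values
at `ω` of polynomials `c g` and `c f`, whose coefficients are jointly bounded. -/
theorem exists_common_factor_of_triple {R : Type*} [CommRing R] [IsDomain R] {ω : R}
    (hω : ω ^ n = θ) (hθ : θ ≠ 0) (hk : 1 ≤ k) (hnk : 3 * k < n)
    (hinj : ∀ p : ℤ[X], p.natDegree < n → aeval ω p = 0 → p = 0)
    {A B : ℝ} {a b b' : Fin n → ℤ} (ha : ∀ j, |(a j : ℝ)| ≤ A)
    (hb : ∀ j, |(b j : ℝ)| ≤ B) (hb' : ∀ j, |(b' j : ℝ)| ≤ B)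
    (ha0 : a ≠ 0) (hb0 : b ≠ 0) (hb0' : b' ≠ 0)
    (hab : ∀ i < k, ∑ s, a s * (TmapZ n θ)^[i] (revZ n b) s = 0)
    (hab' : ∀ i < k, ∑ s, a s * (TmapZ n θ)^[i] (revZ n b') s = 0)
    (hdep : ¬ LinearIndependent ℝ (fun i : Fin (2 * k) =>
      if (i : ℕ) < k then (Tmap n θ)^[(i : ℕ)] (fun s => (revZ n b s : ℝ))
      else (Tmap n θ)^[(i : ℕ) - k] (fun s => (revZ n b' s : ℝ)))) :
    ∃ z : Fin k ⊕ Fin k ⊕ Fin (n - k) → ℤ,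
      ∏ i, max 1 |(z i : ℝ)| ≤
        (4 ^ (n - k) * (n - k : ℕ) * (n * (A * (|(θ : ℝ)| ^ n * B)))) ^ (n - k) ∧
      aeval ω (ofFn (n - k) (fun i => z (.inr (.inr i))) * ofFn k (fun i => z (.inl i))) =
        aeval ω (ofFn n a) * aeval ω (ofFn n b) ∧
      aeval ω (ofFn (n - k) (fun i => z (.inr (.inr i))) * ofFn k (fun i => z (.inr (.inl i)))) =
        aeval ω (ofFn n a) * aeval ω (ofFn n b') := by
  have hn : 0 < n := by omega
  have hne : ∀ v : Fin n → ℤ, v ≠ 0 → aeval ω (ofFn n v) ≠ 0 := fun v hv h =>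
    hv (aeval_ofFn_injective hn hinj (by simp only [h, map_zero]))
  obtain ⟨p, hpd, hp, hpc⟩ := exists_natDegree_lt_aeval_eq_mul hω hθ (by omega) ha hb hab
  obtain ⟨q, hqd, hq, hqc⟩ := exists_natDegree_lt_aeval_eq_mul hω hθ (by omega) ha hb' hab'
  have hp0 : p ≠ 0 := by
    rintro rfl
    exact mul_ne_zero (hne a ha0) (hne b hb0) (by rw [← hp, map_zero])
  have hq0 : q ≠ 0 := by
    rintro rfl
    exact mul_ne_zero (hne a ha0) (hne b' hb0') (by rw [← hq, map_zero])
  obtain ⟨F, G, hFG, hFk, hGk, hrel⟩ :=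
    exists_relation_of_not_linearIndependent hω hn hk (two_mul k) hdep
  rw [revPoly_revZ, revPoly_revZ] at hrel
  have hpoly : F * p = G * q := by
    refine sub_eq_zero.1 (hinj _ ?_ ?_)
    · refine (natDegree_sub_le _ _).trans_lt (max_lt ?_ ?_) <;>
        refine natDegree_mul_le.trans_lt ?_ <;> omega
    · rw [map_sub, map_mul, map_mul, hp, hq]
      linear_combination aeval ω (ofFn n a) * hrel
  have hF : F ≠ 0 := by
    rintro rfl
    have := mul_eq_zero.1 (hpoly.symm.trans (zero_mul p))
    tauto
  have hG : G ≠ 0 := by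
    rintro rfl
    have := mul_eq_zero.1 (hpoly.trans (zero_mul q))
    tauto
  obtain ⟨g, f, c, rfl, rfl, hg, hf, hc, hprod⟩ := exists_common_factor_of_relation
    (by omega) hp0 hq0 hpd hqd hpc hqc hF hG hFk hGk hpoly
  refine ⟨Sum.elim (fun i => g.coeff i) (Sum.elim (fun i => f.coeff i) fun i => c.coeff i),
    ?_, ?_, ?_⟩
  · simpa only [Fintype.prod_sum_type, Sum.elim_inl, Sum.elim_inr] using hprod
  · simpa only [Sum.elim_inl, Sum.elim_inr, ofFn_coeff_of_natDegree_lt hc,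
      ofFn_coeff_of_natDegree_lt hg] using hp
  · simpa only [Sum.elim_inl, Sum.elim_inr, ofFn_coeff_of_natDegree_lt hc,
      ofFn_coeff_of_natDegree_lt hf] using hq

variable {K : Type*} [Field K] [NumberField K] {ω : NumberField.RingOfIntegers K}

theorem norm_aeval_ofFn_le (hω : ω ^ n = θ) (hθ : θ ≠ 0) (hn : 0 < n) (σ : K →+* ℂ)
    {A : ℝ} {a : Fin n → ℤ} (ha : ∀ j, |(a j : ℝ)| ≤ A) :
    ‖σ (aeval ω (ofFn n a) : NumberField.RingOfIntegers K)‖ ≤ n * (A * |(θ : ℝ)| ^ n) := by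
  have h1 : 1 ≤ |(θ : ℝ)| := by exact_mod_cast Int.one_le_abs hθ
  have hA : 0 ≤ A := (abs_nonneg _).trans (ha ⟨0, hn⟩)
  have hσ : ‖σ (ω : K)‖ ≤ |(θ : ℝ)| := by
    have h2 : ‖σ (ω : K)‖ ^ n = |(θ : ℝ)| := by
      have h3 : (ω : K) ^ n = (θ : K) := by
        have := congrArg (algebraMap (NumberField.RingOfIntegers K) K) hω
        simpa using this
      rw [← norm_pow, ← map_pow, h3, map_intCast, Complex.norm_intCast]
    refine le_of_pow_le_pow_left₀ hn.ne' (abs_nonneg _) (h2.le.trans ?_)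
    exact le_self_pow₀ h1 hn.ne'
  rw [aeval_ofFn]
  simp only [map_sum, map_mul, map_pow, map_intCast]
  refine (norm_sum_le _ _).trans ?_
  refine (Finset.sum_le_card_nsmul _ _ (A * |(θ : ℝ)| ^ n) fun s _ => ?_).trans (by simp)
  rw [norm_mul, norm_pow, Complex.norm_intCast]
  refine mul_le_mul (ha s) ?_ (by positivity) hA
  calc ‖σ (ω : K)‖ ^ (s : ℕ) ≤ |(θ : ℝ)| ^ (s : ℕ) := by gcongr
    _ ≤ |(θ : ℝ)| ^ n := pow_le_pow_right₀ h1 s.2.le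

/-- The triples `(a, b, b')` of nonzero vectors with entries at most `A`, `B` and `B`, where `a` is
orthogonal to the first `k` shifts of the reversals of `b` and `b'` and these shifts are linearly
dependent. -/
def degenerateTriples (n k : ℕ) (θ : ℤ) (A B : ℝ) :
    Set ((Fin n → ℤ) × (Fin n → ℤ) × (Fin n → ℤ)) :=
  {t | (t.1 ≠ 0 ∧ ∀ j, |(t.1 j : ℝ)| ≤ A) ∧ (t.2.1 ≠ 0 ∧ ∀ j, |(t.2.1 j : ℝ)| ≤ B) ∧
    (t.2.2 ≠ 0 ∧ ∀ j, |(t.2.2 j : ℝ)| ≤ B) ∧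
    (∀ i < k, ∑ s, t.1 s * ((TmapZ n θ)^[i] (revZ n t.2.1)) s = 0 ∧
      ∑ s, t.1 s * ((TmapZ n θ)^[i] (revZ n t.2.2)) s = 0) ∧
    ¬ LinearIndependent ℝ (fun i : Fin (2 * k) =>
      if (i : ℕ) < k then (Tmap n θ)^[(i : ℕ)] (fun s => ((revZ n t.2.1 s : ℝ)))
      else (Tmap n θ)^[(i : ℕ) - k] (fun s => ((revZ n t.2.2 s : ℝ))))}

theorem exists_ncard_degenerateTriples_le_of_root (hω : ω ^ n = θ) (hθ : θ ≠ 0) (hk : 1 ≤ k)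
    (hnk : 3 * k < n) (hinj : ∀ p : ℤ[X], p.natDegree < n → aeval ω p = 0 → p = 0)
    {ε : ℝ} (hε : 0 < ε) :
    ∃ C : ℝ, 0 < C ∧ ∀ A B : ℝ, 1 ≤ A → 1 ≤ B → ∀ T ⊆ degenerateTriples n k θ A B,
      (T.ncard : ℝ) ≤ C * (A * B) ^ ((n : ℝ) - k + 2 * ε) := by
  have hn : 0 < n := by omega
  have hN : (0 : ℝ) < (n - k : ℕ) := by exact_mod_cast (show 0 < n - k by omega)
  have hNr : ((n - k : ℕ) : ℝ) = n - k := Nat.cast_sub (by omega)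
  have h1 : 1 ≤ |(θ : ℝ)| := by exact_mod_cast Int.one_le_abs hθ
  have h1n : (1 : ℝ) ≤ n := by exact_mod_cast hn
  obtain ⟨S, hS, hcount⟩ := exists_ncard_prod_max_one_abs_le
    (Fin k ⊕ Fin k ⊕ Fin (n - k)) (div_pos hε hN)
  obtain ⟨M, hM, hdiv⟩ := exists_card_bounded_divisors_le K hε
  set c₁ : ℝ := 4 ^ (n - k) * (n - k : ℕ) * (n * |(θ : ℝ)| ^ n) with hc₁
  set c₂ : ℝ := (n * |(θ : ℝ)| ^ n) ^ 2 with hc₂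
  have hc₁0 : 0 < c₁ := by positivity
  have hc₂0 : 0 < c₂ := by positivity
  refine ⟨S * c₁ ^ ((n : ℝ) - k + ε) * (M * c₂ ^ ε), by positivity, fun A B hA hB T hT => ?_⟩
  have hA0 : 0 < A := by linarith
  have hB0 : 0 < B := by linarith
  have hθn : 1 ≤ |(θ : ℝ)| ^ n := one_le_pow₀ h1
  have hY : ∀ X : ℝ, 1 ≤ X → 1 ≤ n * (X * |(θ : ℝ)| ^ n) := fun X hX =>
    one_le_mul_of_one_le_of_one_le h1n (one_le_mul_of_one_le_of_one_le hX hθn)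
  set Y : ℝ := n * (A * |(θ : ℝ)| ^ n) * (n * (B * |(θ : ℝ)| ^ n)) with hYdef
  have hYc : Y = c₂ * (A * B) := by rw [hYdef, hc₂]; ring
  have hY1 : 1 ≤ Y := one_le_mul_of_one_le_of_one_le (hY A hA) (hY B hB)
  set W : ℝ := (4 ^ (n - k) * (n - k : ℕ) * (n * (A * (|(θ : ℝ)| ^ n * B)))) ^ (n - k) with hW
  have hWc : W = (c₁ * (A * B)) ^ (n - k) := by rw [hW, hc₁]; ring
  have hex : ∀ t ∈ T, ∃ z : Fin k ⊕ Fin k ⊕ Fin (n - k) → ℤ, _ :=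
    fun t ht =>
      have ⟨⟨ha0, ha⟩, ⟨hb0, hb⟩, ⟨hb0', hb'⟩, horth, hdep⟩ := hT ht
      exists_common_factor_of_triple hω hθ hk hnk hinj ha hb hb' ha0 hb0 hb0'
        (fun i hi => (horth i hi).1) (fun i hi => (horth i hi).2) hdep
  choose! z hz using hex
  have hofFn := aeval_ofFn_injective hn hinj
  have hne : ∀ v : Fin n → ℤ, v ≠ 0 → aeval ω (ofFn n v) ≠ 0 := fun v hv h =>
    hv (hofFn (by simp only [h, map_zero]))
  have hmain := ncard_le_mul_of_fiber (T := T) (q := z)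
    (x := fun t => aeval ω (ofFn n t.1))
    (Q := {z | ∏ i, max 1 |(z i : ℝ)| ≤ W})
    (D := fun z => {x | x ∣ aeval ω (ofFn (n - k) (fun i => z (.inr (.inr i))) *
      ofFn k (fun i => z (.inl i))) ∧ ∀ σ : K →+* ℂ, ‖σ x‖ ≤ Y})
    (M := M * Y ^ ε) (by positivity) ?_ (hcount W (by positivity)).1 (fun t ht => (hz t ht).1)
    ?_ ?_
  · refine hmain.trans ((mul_le_mul_of_nonneg_right (hcount W (by positivity)).2
      (by positivity)).trans_eq ?_)
    rw [hYc, hWc, ← Real.rpow_natCast, ← Real.rpow_mul (by positivity),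
      show ((n - k : ℕ) : ℝ) * (1 + ε / (n - k : ℕ)) = n - k + ε by field_simp; rw [hNr],
      Real.mul_rpow hc₁0.le (by positivity), Real.mul_rpow hc₂0.le (by positivity),
      show (n : ℝ) - k + 2 * ε = (n - k + ε) + ε by ring, Real.rpow_add (by positivity) (n - k + ε)]
    ring
  · rintro t ht t' ht' htt
    obtain ⟨hzz, haa⟩ := Prod.mk.inj htt
    obtain ⟨-, h₁, h₂⟩ := hz t ht
    obtain ⟨-, h₁', h₂'⟩ := hz t' ht'
    rw [← hzz] at h₁' h₂'
    have ha := hofFn haa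
    have hα := hne _ (hT ht).1.1
    rw [← ha] at h₁' h₂'
    exact Prod.ext ha (Prod.ext (hofFn (mul_left_cancel₀ hα (h₁.symm.trans h₁')))
      (hofFn (mul_left_cancel₀ hα (h₂.symm.trans h₂'))))
  · intro t ht
    refine ⟨⟨_, (hz t ht).2.1⟩, fun σ => ?_⟩
    exact (norm_aeval_ofFn_le hω hθ hn σ (hT ht).1.2).trans
      (le_mul_of_one_le_right (by linarith [hY A hA]) (hY B hB))
  · intro t ht
    refine hdiv Y hY1 _ ?_ fun σ => ?_
    · rw [(hz t ht).2.1]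
      exact mul_ne_zero (hne _ (hT ht).1.1) (hne _ (hT ht).2.1.1)
    · simp only [(hz t ht).2.1, map_mul, norm_mul]
      exact mul_le_mul (norm_aeval_ofFn_le hω hθ hn σ (hT ht).1.2)
        (norm_aeval_ofFn_le hω hθ hn σ (hT ht).2.1.2) (norm_nonneg _) (by linarith [hY A hA])

end Count

section Main

open Polynomial

theorem exists_numberField_root {n : ℕ} {θ : ℤ} (hn : 0 < n)
    (hirr : Irreducible ((X : ℚ[X]) ^ n - C (θ : ℚ))) :
    ∃ (K : Type) (_ : Field K) (_ : NumberField K) (ω : NumberField.RingOfIntegers K),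
      ω ^ n = θ ∧ ∀ p : ℤ[X], p.natDegree < n → aeval ω p = 0 → p = 0 := by
  have : Fact (Irreducible ((X : ℚ[X]) ^ n - C (θ : ℚ))) := ⟨hirr⟩
  have hmonic : ((X : ℚ[X]) ^ n - C (θ : ℚ)).Monic := monic_X_pow_sub_C _ hn.ne'
  have : FiniteDimensional ℚ (AdjoinRoot ((X : ℚ[X]) ^ n - C (θ : ℚ))) :=
    (AdjoinRoot.powerBasis hirr.ne_zero).finite
  have : CharZero (AdjoinRoot ((X : ℚ[X]) ^ n - C (θ : ℚ))) :=
    algebraRat.charZero _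
  have : NumberField (AdjoinRoot ((X : ℚ[X]) ^ n - C (θ : ℚ))) :=
    { to_charZero := inferInstance, to_finiteDimensional := inferInstance }
  have hroot : AdjoinRoot.root ((X : ℚ[X]) ^ n - C (θ : ℚ)) ^ n = (θ : AdjoinRoot _) := by
    have h := AdjoinRoot.eval₂_root ((X : ℚ[X]) ^ n - C (θ : ℚ))
    rw [eval₂_sub, eval₂_X_pow, eval₂_C] at h
    exact (sub_eq_zero.1 h).trans (map_intCast _ _)
  have hint : IsIntegral ℤ (AdjoinRoot.root ((X : ℚ[X]) ^ n - C (θ : ℚ))) := by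
    refine IsIntegral.of_pow hn ?_
    rw [hroot]
    exact isIntegral_algebraMap (R := ℤ) (x := θ)
  obtain ⟨ω, hω⟩ := (IsIntegralClosure.isIntegral_iff
    (A := NumberField.RingOfIntegers (AdjoinRoot ((X : ℚ[X]) ^ n - C (θ : ℚ))))).1 hint
  refine ⟨_, inferInstance, inferInstance, ω, ?_, fun p hp h => ?_⟩
  · refine FaithfulSMul.algebraMap_injective _ (AdjoinRoot ((X : ℚ[X]) ^ n - C (θ : ℚ))) ?_
    rw [map_pow, hω, hroot]
    exact (map_intCast _ _).symm
  · have h' := congrArg (algebraMap _ (AdjoinRoot ((X : ℚ[X]) ^ n - C (θ : ℚ)))) h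
    rw [← aeval_algebraMap_apply, map_zero, hω] at h'
    have h2 : AdjoinRoot.mk ((X : ℚ[X]) ^ n - C (θ : ℚ)) (p.map (algebraMap ℤ ℚ)) = 0 := by
      rw [← AdjoinRoot.aeval_eq, aeval_map_algebraMap]
      exact h'
    by_contra hp0
    refine hmonic.not_dvd_of_natDegree_lt ?_ ?_ (AdjoinRoot.mk_eq_zero.1 h2)
    · rwa [Ne, Polynomial.map_eq_zero_iff (algebraMap ℤ ℚ).injective_int]
    · rw [natDegree_X_pow_sub_C]
      exact natDegree_map_le.trans_lt hp

theorem rpow_diagonal_le {n k : ℕ} (hk : 1 ≤ k) (hnk : k < n) {δ ε A B : ℝ} (hδ : 0 < δ)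
    (hδ1 : δ < 1) (hε : 0 ≤ ε) (hεδ : ε * (n / k) ≤ 2 / 3 * δ) (hA : 0 < A) (hB : 1 ≤ B)
    (hAB : A ^ ((k : ℝ) / (1 - δ)) < B ^ ((n : ℝ) - k)) :
    (A * B) ^ ((n : ℝ) - k + ε) ≤
      A ^ ((n : ℝ) - 2 * k) * B ^ (2 * (n : ℝ) - 2 * k - δ / 3) := by
  have hB0 : 0 < B := by linarith
  have hk0 : (0 : ℝ) < k := by exact_mod_cast hk
  have hnk1 : (k : ℝ) + 1 ≤ n := by exact_mod_cast hnk
  have hδ2 : 0 < 1 - δ := by linarith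
  have hkey : A ^ ((k : ℝ) + ε) ≤ B ^ ((n : ℝ) - k - δ / 3 - ε) := by
    have h := Real.rpow_le_rpow (by positivity) hAB.le
      (show 0 ≤ (1 - δ) / k * (k + ε) by positivity)
    rw [← Real.rpow_mul hA.le, ← Real.rpow_mul hB0.le] at h
    rw [show (k : ℝ) / (1 - δ) * ((1 - δ) / k * (k + ε)) = k + ε by field_simp] at h
    refine h.trans (Real.rpow_le_rpow_of_exponent_le hB ?_)
    have e : ((n : ℝ) - k) * ((1 - δ) / k * (k + ε)) =
        (n - k) * (1 - δ) + (1 - δ) * (ε * (n / k) - ε) := by field_simp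
    have h2 : 0 ≤ ε * (n / k) - ε := by
      rw [sub_nonneg]
      exact le_mul_of_one_le_right hε ((one_le_div hk0).2 (by linarith))
    have h3 : (1 - δ) * (ε * (n / k) - ε) ≤ ε * (n / k) - ε :=
      mul_le_of_le_one_left h2 (by linarith)
    have h4 : δ ≤ (n - k) * δ := le_mul_of_one_le_left hδ.le (by linarith)
    rw [e]
    linarith
  calc (A * B) ^ ((n : ℝ) - k + ε)
      = A ^ ((n : ℝ) - 2 * k) * A ^ ((k : ℝ) + ε) * B ^ ((n : ℝ) - k + ε) := by
        rw [Real.mul_rpow hA.le hB0.le, ← Real.rpow_add hA]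
        congr 2
        ring
    _ ≤ A ^ ((n : ℝ) - 2 * k) * B ^ ((n : ℝ) - k - δ / 3 - ε) * B ^ ((n : ℝ) - k + ε) := by
        gcongr
    _ = _ := by
        rw [mul_assoc, ← Real.rpow_add hB0]
        congr 2
        ring

end Main

/-- **Diagonal terms bound.**  Let `n > 3k` and `δ > 0` sufficiently small in terms of `n,k`.
If `A, B ≥ 2` satisfy `A^{k/(1-δ)} < B^{n-k}`, then the number of triples `(a, b₁, b₂)` with
`‖a‖ ∈ [A,2A]`, `‖b₁‖, ‖b₂‖ ∈ [B,2B]`, `a ∈ Λ_{b₁,b₂}` and `∧(b₁,b₂) = 0` (i.e. the `2k`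
vectors `Tⁱ(rev b₁), Tⁱ(rev b₂)` for `0 ≤ i < k` are linearly dependent over ℝ) is
`≪ A^{n-2k} B^{2n-2k-δ/3}`. -/
theorem stmt_19 (n k : ℕ) (hk : 1 ≤ k) (hnk : 3 * k < n) (θ : ℤ) (hθ : θ ≠ 0)
    (hirr : Irreducible ((Polynomial.X : Polynomial ℚ) ^ n - Polynomial.C (θ : ℚ))) :
    ∃ δ₀ : ℝ, 0 < δ₀ ∧ ∀ δ : ℝ, 0 < δ → δ ≤ δ₀ →
      ∃ C : ℝ, 0 < C ∧ ∀ A B : ℝ, 2 ≤ A → 2 ≤ B →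
        A ^ ((k : ℝ) / (1 - δ)) < B ^ ((n : ℝ) - k) →
        (Nat.card {t : (Fin n → ℤ) × (Fin n → ℤ) × (Fin n → ℤ) |
            (A ≤ nrmZ t.1 ∧ nrmZ t.1 ≤ 2 * A) ∧
            (B ≤ nrmZ t.2.1 ∧ nrmZ t.2.1 ≤ 2 * B) ∧
            (B ≤ nrmZ t.2.2 ∧ nrmZ t.2.2 ≤ 2 * B) ∧
            (∀ i < k, ∑ s, t.1 s * ((TmapZ n θ)^[i] (revZ n t.2.1)) s = 0 ∧
              ∑ s, t.1 s * ((TmapZ n θ)^[i] (revZ n t.2.2)) s = 0) ∧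
            ¬ LinearIndependent ℝ (fun i : Fin (2 * k) =>
              if (i : ℕ) < k then
                (Tmap n θ)^[(i : ℕ)] (fun s => ((revZ n t.2.1 s : ℝ)))
              else
                (Tmap n θ)^[(i : ℕ) - k] (fun s => ((revZ n t.2.2 s : ℝ))))} : ℝ)
          ≤ C * A ^ ((n : ℝ) - 2 * k) * B ^ (2 * (n : ℝ) - 2 * k - δ / 3) := by
  have hkn : 0 < (k : ℝ) / n :=
    div_pos (by exact_mod_cast hk) (by exact_mod_cast (show 0 < n by omega))
  obtain ⟨K, _, _, ω, hω, hinj⟩ := exists_numberField_root (by omega) hirr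
  refine ⟨1 / 2, by norm_num, fun δ hδ hδ' => ?_⟩
  have hε : 0 < δ / 3 * (k / n) := by positivity
  obtain ⟨C, hC, hcount⟩ := exists_ncard_degenerateTriples_le_of_root hω hθ hk hnk hinj hε
  set e : ℝ := (n : ℝ) - k + 2 * (δ / 3 * (k / n))
  refine ⟨C * 4 ^ e, by positivity, fun A B hA hB hAB => ?_⟩
  rw [Nat.card_coe_set_eq]
  refine (hcount (2 * A) (2 * B) (by linarith) (by linarith) _ ?_).trans ?_
  · rintro t ⟨ha, hb, hb', h⟩
    exact ⟨⟨ne_zero_of_nrmZ_pos (by linarith), fun j => (abs_le_nrmZ _ j).trans ha.2⟩,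
      ⟨ne_zero_of_nrmZ_pos (by linarith), fun j => (abs_le_nrmZ _ j).trans hb.2⟩,
      ⟨ne_zero_of_nrmZ_pos (by linarith), fun j => (abs_le_nrmZ _ j).trans hb'.2⟩, h⟩
  · rw [show 2 * A * (2 * B) = 4 * (A * B) by ring,
      Real.mul_rpow (by norm_num) (by positivity), ← mul_assoc, mul_assoc (C * 4 ^ e)]
    gcongr
    refine rpow_diagonal_le hk (by omega) hδ (by linarith) (by positivity) (le_of_eq ?_)
      (by linarith) (by linarith) hAB
    have hk0 : (k : ℝ) ≠ 0 := by exact_mod_cast (show k ≠ 0 by omega)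
    have hn0 : (n : ℝ) ≠ 0 := by exact_mod_cast (show n ≠ 0 by omega)
    field_simp
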